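/- Let X ∈ ℝ^{n×p}, let E ⊆ {1,…,p} with |E| = k, suppose the column submatrix X_E has full column rank, let λ ≠ 0, and fix a sign vector z_E ∈ {−1,1}^E. Define the affine map Ψ : ℝ^n × ℝ^E × ℝ^{Eᶜ} → ℝ^n × ℝ^p by Ψ(y, β_E, z_{−E}) = (y, λ·(z_E ⊕ z_{−E}) − Xᵀ(y − X_E β_E)), where z_E ⊕ z_{−E} ∈ ℝ^p places z_E on coordinates E and z_{−E} on coordinates Eᶜ. Then Ψ is a bijection, and the pushforward of Lebesgue measure on ℝ^n × ℝ^E × ℝ^{Eᶜ} under Ψ equals (|λ|^{p−k} · det(X_EᵀX_E))⁻¹ times Lebesgue measure on ℝ^n × ℝ^p. (This is the change-of-variables underlying the paper's Theorem 2.2 and Corollary 3.1: the reconstruction map ψ(y, β_E, z_{−E}) = (y, ω) transports the joint law of (y, β̂_E, ẑ_{−E}) to the product law of (y, ω) with constant Jacobian factor λ^{p−|E|} det(X_EᵀX_E).) -/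

import Mathlib

open Matrix MeasureTheory

namespace Matrix

variable {m ι : Type*}

/-- The matrix that agrees with `G` on the columns in `E` and with `c • 1` on the others. -/
def replaceColsByScalar {R : Type*} [Zero R] [DecidableEq ι]
    (G : Matrix ι ι R) (E : Finset ι) (c : R) : Matrix ι ι R :=
  of fun i j => if j ∈ E then G i j else if i = j then c else 0

theorem det_replaceColsByScalar {R : Type*} [CommRing R] [Fintype ι] [DecidableEq ι]
    (G : Matrix ι ι R) (E : Finset ι) (c : R) :
    (G.replaceColsByScalar E c).det =
      (G.submatrix (fun e : E => (e : ι)) (fun e : E => (e : ι))).det *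
        c ^ (Fintype.card ι - E.card) := by
  rw [twoBlockTriangular_det' (G.replaceColsByScalar E c) (· ∈ E)]
  · have hE : (G.replaceColsByScalar E c).toSquareBlockProp (· ∈ E) =
        G.submatrix (fun e : E => (e : ι)) (fun e : E => (e : ι)) := by
      ext i j
      simp [replaceColsByScalar, toSquareBlockProp]
    have hEc : (G.replaceColsByScalar E c).toSquareBlockProp (· ∉ E) = diagonal fun _ => c := by
      ext i j
      simp [replaceColsByScalar, toSquareBlockProp, diagonal_apply, j.2, Subtype.ext_iff]
    rw [hE, hEc, det_diagonal, Finset.prod_const, Finset.card_univ,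
      Fintype.card_of_subtype Eᶜ (by simp), Finset.card_compl]
    congr!
  · intro i hi j hj
    have hij : i ≠ j := fun h => hj (h ▸ hi)
    simp [replaceColsByScalar, hj, hij]

theorem replaceColsByScalar_mulVec {R : Type*} [CommRing R] [Fintype ι] [DecidableEq ι]
    (G : Matrix ι ι R) (E : Finset ι) (c : R) (β : E → R) (z : {j // j ∉ E} → R) (j : ι) :
    (G.replaceColsByScalar E c *ᵥ fun i => if h : i ∈ E then β ⟨i, h⟩ else z ⟨i, h⟩) j =
      (G.submatrix id (fun e : E => (e : ι)) *ᵥ β) j +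
        c * (if h : j ∈ E then 0 else z ⟨j, h⟩) := by
  have hterm : ∀ i, G.replaceColsByScalar E c j i *
        (if h : i ∈ E then β ⟨i, h⟩ else z ⟨i, h⟩) =
      (if h : i ∈ E then G j i * β ⟨i, h⟩ else 0) +
        if j = i then c * (if h : j ∈ E then 0 else z ⟨j, h⟩) else 0 := by
    intro i
    rcases eq_or_ne j i with rfl | hji
    · by_cases hj : j ∈ E <;> simp [replaceColsByScalar, hj]
    · by_cases hi : i ∈ E <;> simp [replaceColsByScalar, hi, hji]
  simp only [mulVec, dotProduct, hterm, Finset.sum_add_distrib, Finset.sum_ite_eq,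
    Finset.mem_univ, if_true, submatrix_apply, id]
  congr 1
  rw [← Finset.sum_subset (Finset.subset_univ E) (fun i _ hi => by simp [hi]),
    ← Finset.sum_coe_sort E]
  exact Finset.sum_congr rfl fun i _ => by simp

theorem det_transpose_mul_self_pos [Fintype m] [Fintype ι] [DecidableEq ι]
    {A : Matrix m ι ℝ} (hA : A.rank = Fintype.card ι) : 0 < (Aᵀ * A).det := by
  have hinj : Function.Injective A.mulVec := by
    rw [mulVec_injective_iff, linearIndependent_iff_card_eq_finrank_span, Set.finrank,
      ← rank_eq_finrank_span_cols, hA]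
  simpa [conjTranspose_eq_transpose_of_trivial] using (PosDef.conjTranspose_mul_self A hinj).det_pos

end Matrix

namespace MeasureTheory

theorem bijective_and_map_mulVec_add_piEquivPiSubtypeProd_symm {ι : Type*} [Fintype ι]
    [DecidableEq ι] (E : Finset ι) {M : Matrix ι ι ℝ} (hM : M.det ≠ 0) (b : ι → ℝ) :
    let f : (E → ℝ) × ({i // i ∉ E} → ℝ) → ι → ℝ := fun v =>
      M *ᵥ (MeasurableEquiv.piEquivPiSubtypeProd (fun _ => ℝ) (· ∈ E)).symm v + b
    Function.Bijective f ∧ Measure.map f volume = (ENNReal.ofReal |M.det|)⁻¹ • volume := by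
  intro f
  let glue := (MeasurableEquiv.piEquivPiSubtypeProd (fun _ : ι => ℝ) (· ∈ E)).symm
  have hunit : IsUnit M := (isUnit_iff_isUnit_det M).2 (isUnit_iff_ne_zero.2 hM)
  have hbij : Function.Bijective M.mulVec :=
    ⟨mulVec_injective_iff_isUnit.2 hunit, mulVec_surjective_iff_isUnit.2 hunit⟩
  have hglue : Measure.map glue (volume : Measure ((E → ℝ) × ({i // i ∉ E} → ℝ))) = volume := by
    convert (volume_preserving_piEquivPiSubtypeProd (fun _ : ι => ℝ) (· ∈ E)).symm.map_eq
    rfl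
  have hlin : Measurable (toLin' M) := (toLin' M).continuous_of_finiteDimensional.measurable
  refine ⟨(Equiv.addRight b).bijective.comp (hbij.comp glue.bijective), ?_⟩
  change Measure.map ((· + b) ∘ toLin' M ∘ glue) volume = _
  rw [← Measure.map_map (measurable_add_const b) (hlin.comp glue.measurable),
    ← Measure.map_map hlin glue.measurable, hglue,
    Real.map_matrix_volume_pi_eq_smul_volume_pi hM, Measure.map_smul,
    map_add_right_eq_self, abs_inv, ENNReal.ofReal_inv_of_pos (abs_pos.2 hM)]

theorem bijective_and_map_fiberwise {α β γ : Type*} [MeasureSpace α] [MeasureSpace β]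
    [MeasureSpace γ] [SFinite (volume : Measure α)] [SFinite (volume : Measure β)]
    [SFinite (volume : Measure γ)] {g : α → β → γ} (hg : Measurable (Function.uncurry g))
    {c : ENNReal} (h : ∀ a, Function.Bijective (g a) ∧ Measure.map (g a) volume = c • volume) :
    Function.Bijective (fun x : α × β => (x.1, g x.1 x.2)) ∧
      Measure.map (fun x : α × β => (x.1, g x.1 x.2)) volume = c • volume := by
  refine ⟨⟨?_, ?_⟩, ?_⟩
  · rintro ⟨a, b⟩ ⟨a', b'⟩ hab
    obtain ⟨rfl, hb⟩ := Prod.mk.inj hab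
    exact Prod.ext rfl ((h a).1.1 hb)
  · rintro ⟨a, w⟩
    obtain ⟨b, rfl⟩ := (h a).1.2 w
    exact ⟨(a, b), rfl⟩
  · have hmp := (MeasurePreserving.id (volume : Measure α)).skew_product hg
      (Filter.Eventually.of_forall fun a => (h a).2)
    rw [Measure.prod_smul_right] at hmp
    exact hmp.map_eq

end MeasureTheory

/-- Change of variables underlying the paper's Theorem 2.2 / Corollary 3.1:
the randomized-Lasso reconstruction map
`Ψ(y, β_E, z_{−E}) = (y, λ(z_E ⊕ z_{−E}) − Xᵀ(y − X_E β_E))` is a bijection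
transporting Lebesgue measure with constant Jacobian factor
`|λ|^{p−k} det(X_EᵀX_E)`. -/
theorem randomized_lasso_change_of_variables
    (n p k : ℕ) (X : Matrix (Fin n) (Fin p) ℝ)
    (E : Finset (Fin p)) (hk : E.card = k)
    (hrank : (X.submatrix id (fun e : E => (e : Fin p))).rank = k)
    (lam : ℝ) (hlam : lam ≠ 0)
    (zE : E → ℝ) (hzE : ∀ e, zE e = 1 ∨ zE e = -1)
    (Ψ : (Fin n → ℝ) × (E → ℝ) × ({j : Fin p // j ∉ E} → ℝ) →
      (Fin n → ℝ) × (Fin p → ℝ))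
    (hΨ : ∀ y (βE : E → ℝ) (zmE : {j : Fin p // j ∉ E} → ℝ),
      Ψ (y, βE, zmE) =
        (y, fun j : Fin p =>
          lam * (if h : j ∈ E then zE ⟨j, h⟩ else zmE ⟨j, h⟩) -
            Xᵀ.mulVec (y - (X.submatrix id (fun e : E => (e : Fin p))).mulVec βE) j)) :
    Function.Bijective Ψ ∧
    Measure.map Ψ volume =
      (ENNReal.ofReal (|lam| ^ (p - k) *
        ((X.submatrix id (fun e : E => (e : Fin p)))ᵀ *
          (X.submatrix id (fun e : E => (e : Fin p)))).det))⁻¹ • volume := by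
  classical
  set A := X.submatrix id (fun e : E => (e : Fin p))
  have hdetA : 0 < (Aᵀ * A).det := det_transpose_mul_self_pos (by rw [hrank, Fintype.card_coe, hk])
  set M := (Xᵀ * X).replaceColsByScalar E lam with hM
  have hdetM : |M.det| = |lam| ^ (p - k) * (Aᵀ * A).det := by
    have hsub : (Xᵀ * X).submatrix (fun e : E => (e : Fin p)) (fun e : E => (e : Fin p)) =
        Aᵀ * A := rfl
    rw [hM, det_replaceColsByScalar, hsub, abs_mul, abs_of_pos hdetA, abs_pow, Fintype.card_fin,
      hk, mul_comm]
  have hne : M.det ≠ 0 := by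
    rw [← abs_pos, hdetM]
    positivity
  let b : (Fin n → ℝ) → Fin p → ℝ := fun y =>
    (fun j => lam * if h : j ∈ E then zE ⟨j, h⟩ else 0) - Xᵀ *ᵥ y
  let glue := (MeasurableEquiv.piEquivPiSubtypeProd (fun _ : Fin p => ℝ) (· ∈ E)).symm
  let g : (Fin n → ℝ) → (E → ℝ) × ({j : Fin p // j ∉ E} → ℝ) → Fin p → ℝ :=
    fun y v => M *ᵥ glue v + b y
  have hΨg : Ψ = fun x => (x.1, g x.1 x.2) := by
    ext1 ⟨y, β, z⟩
    rw [hΨ]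
    refine Prod.ext rfl (funext fun j => ?_)
    have hglue := replaceColsByScalar_mulVec (Xᵀ * X) E lam β z j
    have hgram : (Xᵀ * X).submatrix id (fun e : E => (e : Fin p)) = Xᵀ * A := rfl
    rw [hgram, ← mulVec_mulVec] at hglue
    change _ = (M *ᵥ fun i => if h : i ∈ E then β ⟨i, h⟩ else z ⟨i, h⟩) j + b y j
    rw [hglue, mulVec_sub]
    by_cases hj : j ∈ E <;> simp [b, hj] <;> ring
  have hg : Measurable (Function.uncurry g) := by
    have hM_meas : Measurable M.mulVec :=
      (Continuous.matrix_mulVec continuous_const continuous_id).measurable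
    have hX_meas : Measurable (Xᵀ).mulVec :=
      (Continuous.matrix_mulVec continuous_const continuous_id).measurable
    exact (hM_meas.comp (glue.measurable.comp measurable_snd)).add
      (measurable_const.sub (hX_meas.comp measurable_fst))
  rw [hΨg, ← hdetM]
  exact bijective_and_map_fiberwise hg fun y =>
    bijective_and_map_mulVec_add_piEquivPiSubtypeProd_symm E hne (b y)
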